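/- (Mishchenko–Fomenko for gl_d.) Let f, g lie in the Poisson center of R, i.e. {f, h} = 0 and {g, h} = 0 for all h ∈ R. Then for every matrix ξ ∈ M_d(K) and all nonnegative integers p, q, one has {∂_ξ^p f, ∂_ξ^q g} = 0, where ∂_ξ := Σ_{i,j} ξ^i_j ∂/∂x_{ij}. -/

import Mathlib

noncomputable section

open MvPolynomial

/-- The Lie–Poisson bracket on `R = K[x_{ij}]`, the coordinate ring of `gl_d*`:
`{f, g} = Σ_{i,j,p,q} (δ_{pj} x_{iq} − δ_{iq} x_{pj}) (∂f/∂x_{ij}) (∂g/∂x_{pq})`. -/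
noncomputable def liePoisson (K : Type*) [Field K] (d : ℕ)
    (f g : MvPolynomial (Fin d × Fin d) K) : MvPolynomial (Fin d × Fin d) K :=
  ∑ i, ∑ j, ∑ p, ∑ q,
    ((if p = j then X (i, q) else 0) - (if i = q then X (p, j) else 0)) *
      pderiv (i, j) f * pderiv (p, q) g

/-- The bracket of Lie–Poisson shape whose structure coefficients are taken from a matrix `c`
with polynomial entries. The Lie–Poisson bracket is the case `c = X`, and the frozen bracket at
`ξ` is the case of the constant matrix `ξ`. -/
noncomputable def coeffBracket {R : Type*} [CommRing R] {d : ℕ}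
    (c : Fin d × Fin d → MvPolynomial (Fin d × Fin d) R)
    (f g : MvPolynomial (Fin d × Fin d) R) : MvPolynomial (Fin d × Fin d) R :=
  ∑ i, ∑ j, ∑ p, ∑ q,
    ((if p = j then c (i, q) else 0) - (if i = q then c (p, j) else 0)) *
      pderiv (i, j) f * pderiv (p, q) g

theorem coeffBracket_antisymm {R : Type*} [CommRing R] {d : ℕ}
    (c : Fin d × Fin d → MvPolynomial (Fin d × Fin d) R)
    (f g : MvPolynomial (Fin d × Fin d) R) :
    coeffBracket c f g = -coeffBracket c g f := by
  simp only [coeffBracket, ← Fintype.sum_prod_type', ← Finset.sum_neg_distrib]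
  refine Fintype.sum_equiv
    ⟨fun x => (x.2.2.1, x.2.2.2, x.1, x.2.1), fun x => (x.2.2.1, x.2.2.2, x.1, x.2.1),
      fun _ => rfl, fun _ => rfl⟩ _ _ ?_
  rintro ⟨i, j, p, q⟩
  simp only [Equiv.coe_fn_mk]
  ring

theorem coeffBracket_zero {R : Type*} [CommRing R] {d : ℕ}
    (f g : MvPolynomial (Fin d × Fin d) R) : coeffBracket 0 f g = 0 := by
  simp [coeffBracket]

/-- A derivation commuting with the partial derivatives obeys a Leibniz rule for
`coeffBracket`. -/
theorem derivation_coeffBracket {R : Type*} [CommRing R] {d : ℕ}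
    (D : Derivation R (MvPolynomial (Fin d × Fin d) R) (MvPolynomial (Fin d × Fin d) R))
    (hD : ∀ i f, D (pderiv i f) = pderiv i (D f))
    (c : Fin d × Fin d → MvPolynomial (Fin d × Fin d) R)
    (f g : MvPolynomial (Fin d × Fin d) R) :
    D (coeffBracket c f g) =
      coeffBracket (D ∘ c) f g + coeffBracket c (D f) g + coeffBracket c f (D g) := by
  simp only [coeffBracket, map_sum, ← Finset.sum_add_distrib]
  refine Finset.sum_congr rfl fun i _ => Finset.sum_congr rfl fun j _ =>
    Finset.sum_congr rfl fun p _ => Finset.sum_congr rfl fun q _ => ?_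
  simp only [Derivation.leibniz, smul_eq_mul, map_sub, apply_ite D, map_zero, hD,
    Function.comp_apply]
  ring

/-- If `f` is in the Poisson center, bracketing with an iterated derivative of `f` is, up to a
scalar, bracketing with the preceding derivative for the differentiated coefficients. -/
theorem coeffBracket_iterate_succ {R : Type*} [CommRing R] {d : ℕ}
    (D : Derivation R (MvPolynomial (Fin d × Fin d) R) (MvPolynomial (Fin d × Fin d) R))
    (hD : ∀ i f, D (pderiv i f) = pderiv i (D f))
    (c : Fin d × Fin d → MvPolynomial (Fin d × Fin d) R) (hc : D ∘ D ∘ c = 0)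
    (f : MvPolynomial (Fin d × Fin d) R) (hf : ∀ h, coeffBracket c f h = 0) (n : ℕ)
    (h : MvPolynomial (Fin d × Fin d) R) :
    coeffBracket c (D^[n + 1] f) h = -((n + 1 : ℕ) * coeffBracket (D ∘ c) (D^[n] f) h) := by
  induction n generalizing h with
  | zero =>
    have key := derivation_coeffBracket D hD c f h
    rw [hf, hf, map_zero] at key
    simp only [zero_add, Function.iterate_one, Function.iterate_zero, id_eq, Nat.cast_one]
    linear_combination -key
  | succ n ih =>
    have key := derivation_coeffBracket D hD c (D^[n + 1] f) h
    have frozen := derivation_coeffBracket D hD (D ∘ c) (D^[n] f) h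
    rw [hc, coeffBracket_zero, zero_add, ← Function.iterate_succ_apply' D] at frozen
    rw [← Function.iterate_succ_apply' D, ih h, ih (D h)] at key
    simp only [map_neg, Derivation.leibniz, Derivation.map_natCast, smul_eq_mul, frozen] at key
    push_cast at key ⊢
    linear_combination -key

/-- The argument-shift argument: iterated derivatives of Poisson-central elements commute. -/
theorem coeffBracket_iterate_eq_zero {K : Type*} [Field K] [CharZero K] {d : ℕ}
    (D : Derivation K (MvPolynomial (Fin d × Fin d) K) (MvPolynomial (Fin d × Fin d) K))
    (hD : ∀ i f, D (pderiv i f) = pderiv i (D f))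
    (c : Fin d × Fin d → MvPolynomial (Fin d × Fin d) K) (hc : D ∘ D ∘ c = 0)
    (f g : MvPolynomial (Fin d × Fin d) K) (hf : ∀ h, coeffBracket c f h = 0)
    (hg : ∀ h, coeffBracket c g h = 0) (p q : ℕ) :
    coeffBracket c (D^[p] f) (D^[q] g) = 0 := by
  induction p generalizing q with
  | zero => exact hf _
  | succ p ih =>
    have key := ih (q + 1)
    rw [coeffBracket_antisymm, coeffBracket_iterate_succ D hD c hc g hg, neg_neg,
      mul_eq_zero] at key
    have frozen := key.resolve_left (Nat.cast_ne_zero.mpr q.succ_ne_zero)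
    rw [coeffBracket_iterate_succ D hD c hc f hf, coeffBracket_antisymm, frozen]
    simp

theorem mkDerivation_C_pderiv {R σ : Type*} [CommRing R] (v : σ → R) (i : σ)
    (f : MvPolynomial σ R) :
    mkDerivation R (fun j => (C (v j) : MvPolynomial σ R)) (pderiv i f) =
      pderiv i (mkDerivation R (fun j => (C (v j) : MvPolynomial σ R)) f) := by
  classical
  have key :
      ⁅mkDerivation R (fun j => (C (v j) : MvPolynomial σ R)), pderiv (R := R) i⁆ = 0 := by
    refine derivation_ext fun j => ?_
    rw [Derivation.commutator_apply, pderiv_X, mkDerivation_X, pderiv_C, sub_zero,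
      Pi.single_apply]
    split_ifs <;> simp
  have eval := DFunLike.congr_fun key f
  rwa [Derivation.commutator_apply, Derivation.zero_apply, sub_eq_zero] at eval

theorem sum_smul_pderiv_eq_mkDerivation {R m n : Type*} [CommRing R] [Fintype m] [Fintype n]
    (ξ : Matrix m n R) :
    (∑ i, ∑ j, ξ i j • ((pderiv (i, j)).toLinearMap :
        MvPolynomial (m × n) R →ₗ[R] MvPolynomial (m × n) R)) =
      (mkDerivation R fun x : m × n =>
        (C (ξ x.1 x.2) : MvPolynomial (m × n) R)).toLinearMap := by
  classical
  have apply_sum (f : MvPolynomial (m × n) R) :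
      (∑ x : m × n, ξ x.1 x.2 • pderiv x :
        Derivation R (MvPolynomial (m × n) R) (MvPolynomial (m × n) R)) f =
        ∑ x : m × n, ξ x.1 x.2 • pderiv x f := by
    rw [← Derivation.coeFnAddMonoidHom_apply, map_sum, Finset.sum_apply]
    rfl
  have key : (∑ x : m × n, ξ x.1 x.2 • pderiv x :
      Derivation R (MvPolynomial (m × n) R) (MvPolynomial (m × n) R)) =
      mkDerivation R fun x : m × n => (C (ξ x.1 x.2) : MvPolynomial (m × n) R) := by
    refine derivation_ext fun y => ?_
    simp [apply_sum, pderiv_X, Pi.single_apply, smul_eq_C_mul]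
  refine LinearMap.ext fun f => ?_
  rw [← key, ← Fintype.sum_prod_type' (fun i j => ξ i j • (pderiv (i, j)).toLinearMap)]
  simp [apply_sum, LinearMap.sum_apply]

/-- Mishchenko–Fomenko for `gl_d`: if `f, g` lie in the Poisson center of `R`, then for every
matrix `ξ` and all `p, q ≥ 0`, `{∂_ξ^p f, ∂_ξ^q g} = 0`, where `∂_ξ = Σ_{i,j} ξ^i_j ∂/∂x_{ij}`. -/
theorem stmt18 {K : Type*} [Field K] [CharZero K] {d : ℕ} (hd : 1 ≤ d)
    (f g : MvPolynomial (Fin d × Fin d) K)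
    (hf : ∀ h : MvPolynomial (Fin d × Fin d) K, liePoisson K d f h = 0)
    (hg : ∀ h : MvPolynomial (Fin d × Fin d) K, liePoisson K d g h = 0)
    (ξ : Matrix (Fin d) (Fin d) K) (p q : ℕ) :
    liePoisson K d
      (((∑ i, ∑ j, ξ i j • ((pderiv (i, j)).toLinearMap :
          MvPolynomial (Fin d × Fin d) K →ₗ[K] MvPolynomial (Fin d × Fin d) K)) ^ p) f)
      (((∑ i, ∑ j, ξ i j • ((pderiv (i, j)).toLinearMap :
          MvPolynomial (Fin d × Fin d) K →ₗ[K] MvPolynomial (Fin d × Fin d) K)) ^ q) g)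
      = 0 := by
  rw [sum_smul_pderiv_eq_mkDerivation, Module.End.pow_apply, Module.End.pow_apply]
  refine coeffBracket_iterate_eq_zero _
    (mkDerivation_C_pderiv fun x : Fin d × Fin d => ξ x.1 x.2) X ?_ f g hf hg p q
  ext1 x
  simp
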